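/- Characterization of F-transforms: let F : ℍ → ℍ be holomorphic. Then there exists a Borel probability measure μ on ℝ with F = F_μ on ℍ if and only if lim_{y→∞} F(iy)/(iy) = 1. Moreover, for every Borel probability measure μ on ℝ one has Im F_μ(z) ≥ Im z for all z ∈ ℍ. -/

import Mathlib

open MeasureTheory Filter Topology Set

/-- The Cauchy transform of a measure on ℝ, `G_μ(z) = ∫ 1/(z-x) dμ(x)`. -/
noncomputable def cauchyTransform (μ : Measure ℝ) (z : ℂ) : ℂ :=
  ∫ x, (z - (x : ℂ))⁻¹ ∂μ

/-- The F-transform of a measure on ℝ, `F_μ(z) = 1/G_μ(z)`. -/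
noncomputable def Ftransform (μ : Measure ℝ) (z : ℂ) : ℂ :=
  (cauchyTransform μ z)⁻¹

section CauchyTransform

variable {μ : Measure ℝ} {z : ℂ}

lemma im_le_norm_sub_ofReal (z : ℂ) (x : ℝ) : z.im ≤ ‖z - x‖ := by
  simpa using (le_abs_self _).trans (Complex.abs_im_le_norm (z - x))

lemma sub_ofReal_ne_zero (hz : 0 < z.im) (x : ℝ) : z - x ≠ 0 :=
  norm_pos_iff.1 (hz.trans_le (im_le_norm_sub_ofReal z x))

lemma norm_inv_sub_ofReal_le (hz : 0 < z.im) (x : ℝ) : ‖(z - x)⁻¹‖ ≤ z.im⁻¹ := by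
  rw [norm_inv]
  exact inv_anti₀ hz (im_le_norm_sub_ofReal z x)

lemma inv_sub_ofReal_im (z : ℂ) (x : ℝ) :
    ((z - x)⁻¹).im = -(z.im * ‖(z - x)⁻¹‖ ^ 2) := by
  rw [Complex.inv_im, norm_inv, inv_pow, ← Complex.normSq_eq_norm_sq]
  simp [div_eq_mul_inv]

lemma integrable_inv_sub_ofReal [IsFiniteMeasure μ] (hz : 0 < z.im) :
    Integrable (fun x : ℝ => (z - x)⁻¹) μ :=
  .of_bound (by fun_prop) z.im⁻¹ (ae_of_all _ (norm_inv_sub_ofReal_le hz))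

lemma integrable_norm_inv_sub_ofReal_sq [IsFiniteMeasure μ] (hz : 0 < z.im) :
    Integrable (fun x : ℝ => ‖(z - x)⁻¹‖ ^ 2) μ := by
  refine .of_bound (by fun_prop) (z.im⁻¹ ^ 2) (ae_of_all _ fun x => ?_)
  rw [Real.norm_of_nonneg (by positivity)]
  gcongr
  exact norm_inv_sub_ofReal_le hz x

lemma cauchyTransform_im [IsFiniteMeasure μ] (hz : 0 < z.im) :
    (cauchyTransform μ z).im = -(z.im * ∫ x : ℝ, ‖(z - x)⁻¹‖ ^ 2 ∂μ) := by
  have h := Complex.imCLM.integral_comp_comm (integrable_inv_sub_ofReal (μ := μ) hz)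
  simp only [Complex.imCLM_apply] at h
  rw [cauchyTransform, ← h]
  simp only [inv_sub_ofReal_im]
  rw [integral_neg, integral_const_mul]

lemma im_le_Ftransform_im [IsProbabilityMeasure μ] (hz : 0 < z.im) :
    z.im ≤ (Ftransform μ z).im := by
  have hpos : 0 < ∫ x : ℝ, ‖(z - x)⁻¹‖ ^ 2 ∂μ := by
    rw [integral_pos_iff_support_of_nonneg (fun x => by positivity)
      (integrable_norm_inv_sub_ofReal_sq hz)]
    have : (Function.support fun x : ℝ => ‖(z - x)⁻¹‖ ^ 2) = univ := by
      ext x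
      simp [sub_ofReal_ne_zero hz x]
    rw [this, measure_univ]
    exact one_pos
  have him := cauchyTransform_im (μ := μ) hz
  have hle : ‖cauchyTransform μ z‖ ^ 2 ≤ ∫ x : ℝ, ‖(z - x)⁻¹‖ ^ 2 ∂μ :=
    (convexOn_univ_norm.pow (fun _ _ => norm_nonneg _) 2).map_integral_le (by fun_prop)
      isClosed_univ (by simp) (integrable_inv_sub_ofReal hz)
      (integrable_norm_inv_sub_ofReal_sq hz)
  have hne : cauchyTransform μ z ≠ 0 := by
    intro h
    rw [h, Complex.zero_im] at him
    nlinarith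
  rw [Ftransform, Complex.inv_im, him, neg_neg, Complex.normSq_eq_norm_sq,
    le_div_iff₀ (by positivity)]
  gcongr

lemma differentiableOn_cauchyTransform [IsFiniteMeasure μ] :
    DifferentiableOn ℂ (cauchyTransform μ) {z : ℂ | 0 < z.im} := by
  intro z hz
  simp only [mem_ofPred_eq] at hz
  have hs : {w : ℂ | z.im / 2 < w.im} ∈ 𝓝 z :=
    (isOpen_lt continuous_const Complex.continuous_im).mem_nhds (by simpa using hz)
  refine (hasDerivAt_integral_of_dominated_loc_of_deriv_le (μ := μ)
    (F := fun (w : ℂ) (x : ℝ) => (w - x)⁻¹) (F' := fun (w : ℂ) (x : ℝ) => -1 / (w - x) ^ 2)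
    (bound := fun _ => (z.im / 2)⁻¹ ^ 2) hs (.of_forall fun w => by fun_prop)
    (integrable_inv_sub_ofReal hz) (Measurable.aestronglyMeasurable (by fun_prop))
    (ae_of_all _ fun x w hw => ?_) (integrable_const _)
    (ae_of_all _ fun x w hw => ?_)).2.differentiableAt.differentiableWithinAt
  · have hw' : 0 < w.im := (half_pos hz).trans hw
    rw [norm_div, norm_neg, norm_one, one_div, norm_pow, ← inv_pow]
    gcongr
    exact hw.le.trans (im_le_norm_sub_ofReal w x)
  · have hw' : 0 < w.im := (half_pos hz).trans hw
    exact ((hasDerivAt_id w).sub_const (x : ℂ)).inv (sub_ofReal_ne_zero hw' x)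

lemma tendsto_mul_cauchyTransform [IsProbabilityMeasure μ] :
    Tendsto (fun y : ℝ => (y * Complex.I) * cauchyTransform μ (y * Complex.I)) atTop (𝓝 1) := by
  have key : Tendsto (fun y : ℝ => ∫ x : ℝ, (y * Complex.I) * (y * Complex.I - x)⁻¹ ∂μ) atTop
      (𝓝 (∫ _ : ℝ, 1 ∂μ)) := by
    refine tendsto_integral_filter_of_dominated_convergence (fun _ => 1)
      (.of_forall fun y => by fun_prop) ?_ (integrable_const _) (ae_of_all _ fun x => ?_)
    · filter_upwards [eventually_gt_atTop 0] with y hy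
      refine ae_of_all _ fun x => ?_
      have h := norm_inv_sub_ofReal_le (z := y * Complex.I) (by simpa using hy) x
      rw [norm_mul]
      calc _ ≤ ‖(y : ℂ) * Complex.I‖ * ((y : ℂ) * Complex.I).im⁻¹ := by gcongr
        _ = 1 := by simp [abs_of_pos hy, hy.ne']
    · have h1 : Tendsto (fun y : ℝ => 1 + (x : ℂ) * (y * Complex.I - x)⁻¹) atTop
          (𝓝 (1 + (x : ℂ) * 0)) := by
        refine (Tendsto.const_mul _ (squeeze_zero_norm' ?_ tendsto_inv_atTop_zero)).const_add _
        filter_upwards [eventually_gt_atTop 0] with y hy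
        simpa using norm_inv_sub_ofReal_le (z := y * Complex.I) (by simpa using hy) x
      rw [mul_zero, add_zero] at h1
      refine h1.congr' ?_
      filter_upwards [eventually_gt_atTop 0] with y hy
      have := sub_ofReal_ne_zero (z := y * Complex.I) (by simpa using hy) x
      field_simp
      ring
  simpa [cauchyTransform, integral_const_mul] using key

end CauchyTransform

section Herglotz

open Metric

/-- The normalized arc length measure on the unit circle. -/
noncomputable def circleProbability : Measure (sphere (0 : ℂ) 1) :=
  ENNReal.ofReal (2 * Real.pi)⁻¹ • (volume.restrict (Ioc 0 (2 * Real.pi))).map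
    fun θ => ⟨circleMap 0 1 θ, circleMap_mem_sphere 0 zero_le_one θ⟩

instance : IsFiniteMeasure circleProbability := by
  have := Measure.smul_finite ((volume.restrict (Ioc 0 (2 * Real.pi))).map
    fun θ => (⟨circleMap 0 1 θ, circleMap_mem_sphere 0 zero_le_one θ⟩ : sphere (0 : ℂ) 1))
    (ENNReal.ofReal_ne_top (r := (2 * Real.pi)⁻¹))
  exact this

lemma integral_circleProbability {f : ℂ → ℝ} (hf : ContinuousOn f (sphere 0 1)) :
    ∫ ζ : sphere (0 : ℂ) 1, f ζ ∂circleProbability = Real.circleAverage f 0 1 := by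
  have hc : Continuous fun ζ : sphere (0 : ℂ) 1 => f ζ := hf.comp_continuous (by fun_prop) (by simp)
  rw [circleProbability, integral_smul_measure, integral_map (by fun_prop)
    hc.aestronglyMeasurable, Real.circleAverage_def,
    intervalIntegral.integral_of_le (by positivity), ENNReal.toReal_ofReal (by positivity)]

lemma continuousOn_poissonKernel_sphere {w : ℂ} (hw : w ∈ ball (0 : ℂ) 1) :
    ContinuousOn (poissonKernel 0 w) (sphere 0 1) := by
  rw [poissonKernel_eq_re_herglotzRieszKernel]
  exact Complex.continuous_re.comp_continuousOn
    (by simpa using continuousOn_herglotzRieszKernel_sphere hw)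

/-- The **Herglotz representation**: a holomorphic function on the unit disc with nonnegative real
part has as its real part the Poisson integral of a finite measure on the unit circle. -/
theorem exists_re_eq_integral_poissonKernel {h : ℂ → ℂ} (hd : DifferentiableOn ℂ h (ball 0 1))
    (hnn : ∀ w ∈ ball (0 : ℂ) 1, 0 ≤ (h w).re) :
    ∃ ν : FiniteMeasure (sphere (0 : ℂ) 1), ∀ w ∈ ball (0 : ℂ) 1,
      (h w).re = ∫ ζ, poissonKernel 0 w ζ ∂(ν : Measure (sphere (0 : ℂ) 1)) := by
  have hmem {r : ℝ} (hr : r ∈ Ioo (0 : ℝ) 1) {w : ℂ} (hw : w ∈ closedBall (0 : ℂ) 1) :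
      (r * w : ℂ) ∈ ball (0 : ℂ) 1 := by
    simp only [mem_ball_zero_iff, mem_closedBall_zero_iff, norm_mul, Complex.norm_real,
      Real.norm_of_nonneg hr.1.le] at hw ⊢
    nlinarith [hr.1, hr.2]
  have hcont {r : ℝ} (hr : r ∈ Ioo (0 : ℝ) 1) :
      ContinuousOn (fun w : ℂ => h (r * w)) (closedBall 0 1) :=
    hd.continuousOn.comp (by fun_prop) fun w hw => hmem hr hw
  have hcontS {r : ℝ} (hr : r ∈ Ioo (0 : ℝ) 1) :
      ContinuousOn (fun w : ℂ => (h (r * w)).re) (sphere 0 1) :=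
    Complex.continuous_re.comp_continuousOn ((hcont hr).mono sphere_subset_closedBall)
  have hcontS' {r : ℝ} (hr : r ∈ Ioo (0 : ℝ) 1) :
      Continuous fun ζ : sphere (0 : ℂ) 1 => (h (r * ζ)).re :=
    (hcontS hr).comp_continuous (f := Subtype.val) (by fun_prop) (by simp)
  have hpoisson {r : ℝ} (hr : r ∈ Ioo (0 : ℝ) 1) {w : ℂ} (hw : w ∈ ball (0 : ℂ) 1) :
      Real.circleAverage (fun ζ => (h (r * ζ)).re * poissonKernel 0 w ζ) 0 1 = (h (r * w)).re := by
    have hdc : DiffContOnCl ℂ (fun w : ℂ => h (r * w)) (ball 0 1) := by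
      refine ⟨hd.comp (by fun_prop) fun w hw => hmem hr (ball_subset_closedBall hw), ?_⟩
      rw [closure_ball _ one_ne_zero]
      exact hcont hr
    rw [← hdc.circleAverage_poissonKernel_smul hw, ← Complex.reCLM_apply,
      ← ContinuousLinearMap.circleAverage_comp_comm]
    · congr 1
      ext ζ
      simp [mul_comm]
    · exact ContinuousOn.circleIntegrable zero_le_one ((continuousOn_poissonKernel_sphere hw).smul
        ((hcont hr).mono sphere_subset_closedBall))
  let m (r : ℝ) : Measure (sphere (0 : ℂ) 1) :=
    circleProbability.withDensity fun ζ => ENNReal.ofReal (h (r * ζ)).re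
  have hintegral {r : ℝ} (hr : r ∈ Ioo (0 : ℝ) 1) {w : ℂ} (hw : w ∈ ball (0 : ℂ) 1) :
      ∫ ζ, poissonKernel 0 w ζ ∂(m r) = (h (r * w)).re := by
    rw [← hpoisson hr hw, integral_withDensity_eq_integral_toReal_smul
      (hcontS' hr).measurable.ennreal_ofReal (by simp),
      ← integral_circleProbability ((hcontS hr).fun_mul (continuousOn_poissonKernel_sphere hw))]
    refine integral_congr_ae (ae_of_all _ fun ζ => ?_)
    have := hnn _ (hmem hr (sphere_subset_closedBall ζ.2))
    simp [ENNReal.toReal_ofReal this]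
  have hfin {r : ℝ} (hr : r ∈ Ioo (0 : ℝ) 1) : IsFiniteMeasure (m r) :=
    isFiniteMeasure_withDensity_ofReal
      ((hcontS' hr).integrable_of_hasCompactSupport (HasCompactSupport.of_compactSpace _)).2
  have hmass {r : ℝ} (hr : r ∈ Ioo (0 : ℝ) 1) : (m r).real univ = (h 0).re := by
    have h0 := hintegral hr (mem_ball_self (x := (0 : ℂ)) one_pos)
    have h1 : ∀ ζ : sphere (0 : ℂ) 1, poissonKernel 0 0 (ζ : ℂ) = 1 := fun ζ => by
      simp [poissonKernel_def]
    simpa [h1] using h0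
  classical
  let M (r : ℝ) : FiniteMeasure (sphere (0 : ℂ) 1) :=
    if hr : r ∈ Ioo (0 : ℝ) 1 then ⟨m r, hfin hr⟩ else 0
  let U : Ultrafilter ℝ := Ultrafilter.of (𝓝[<] 1)
  have hU : (U : Filter ℝ) ≤ 𝓝[<] 1 := Ultrafilter.of_le _
  have hIoo : ∀ᶠ r in (U : Filter ℝ), r ∈ Ioo (0 : ℝ) 1 :=
    hU (Ioo_mem_nhdsLT one_pos)
  obtain ⟨ν, -, hν⟩ := isCompact_iff_ultrafilter_le_nhds'.1
    (isCompact_setOfPred_finiteMeasure_le_of_compactSpace (sphere (0 : ℂ) 1) (h 0).re.toNNReal)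
    (U.map M) (by
      rw [Ultrafilter.mem_map]
      filter_upwards [hIoo] with r hr
      have : (M r).mass = (h 0).re.toNNReal := by
        rw [← hmass hr]
        simp [M, hr, FiniteMeasure.mass, Measure.real]
      simp [this])
  refine ⟨ν, fun w hw => tendsto_nhds_unique (f := fun r : ℝ => (h (r * w)).re)
    (l := (U : Filter ℝ)) ?_ ?_⟩
  · have hc : ContinuousAt (fun r : ℝ => (h (r * w)).re) 1 := by
      refine Complex.continuous_re.continuousAt.comp (ContinuousAt.comp (g := h) ?_ (by fun_prop))
      simpa using (hd.differentiableAt (isOpen_ball.mem_nhds hw)).continuousAt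
    simpa using hc.tendsto.mono_left (hU.trans nhdsWithin_le_nhds)
  · have hK : Continuous fun ζ : sphere (0 : ℂ) 1 => poissonKernel 0 w ζ :=
      (continuousOn_poissonKernel_sphere hw).comp_continuous (by fun_prop) (by simp)
    have := FiniteMeasure.tendsto_iff_forall_integral_tendsto.1 (show Tendsto M U (𝓝 ν) from hν)
      (BoundedContinuousFunction.mkOfCompact ⟨_, hK⟩)
    refine this.congr' ?_
    filter_upwards [hIoo] with r hr
    simpa [M, hr] using hintegral hr hw

end Herglotz

section Cayley

open Metric

/-- The real number corresponding to a point of the unit circle other than `1` under the Cayley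
transform `ζ ↦ I * (1 + ζ) / (1 - ζ)`. -/
noncomputable def cayleyReal (ζ : ℂ) : ℝ := -ζ.im / (1 - ζ.re)

lemma measurable_cayleyReal : Measurable cayleyReal := by
  unfold cayleyReal
  fun_prop

lemma ofReal_add_I_ne_zero (t : ℝ) : (t + Complex.I : ℂ) ≠ 0 := fun h => by
  simpa using congrArg Complex.im h

lemma add_I_ne_zero {z : ℂ} (hz : 0 < z.im) : z + Complex.I ≠ 0 := fun h => by
  have := congrArg Complex.im h
  simp only [Complex.add_im, Complex.I_im, Complex.zero_im] at this
  linarith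

lemma cayleyReal_sub_I_div {ζ : ℂ} (hζ : ζ ∈ sphere (0 : ℂ) 1) (h1 : ζ ≠ 1) :
    ζ = (cayleyReal ζ - Complex.I) / (cayleyReal ζ + Complex.I) := by
  have hn : ζ.re ^ 2 + ζ.im ^ 2 = 1 := by
    have := Complex.sq_norm ζ
    rw [mem_sphere_zero_iff_norm.1 hζ, Complex.normSq_apply] at this
    linarith
  have hre : 1 - ζ.re ≠ 0 := fun h => h1 <| by
    have hr : ζ.re = 1 := by linarith
    have hi : ζ.im = 0 := by simpa [hr] using hn
    exact Complex.ext (by simpa using hr) (by simpa using hi)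
  rw [eq_div_iff (ofReal_add_I_ne_zero _)]
  apply Complex.ext
  · simp only [cayleyReal, Complex.mul_re, Complex.add_re, Complex.sub_re, Complex.ofReal_re,
      Complex.add_im, Complex.ofReal_im, Complex.I_re, Complex.I_im]
    field_simp
    ring
  · simp only [cayleyReal, Complex.mul_im, Complex.add_re, Complex.sub_im, Complex.ofReal_re,
      Complex.add_im, Complex.ofReal_im, Complex.I_re, Complex.I_im]
    field_simp
    linarith

lemma one_sub_norm_cayley_sq {z : ℂ} (hz : 0 < z.im) :
    1 - ‖(z - Complex.I) / (z + Complex.I)‖ ^ 2 = 4 * z.im / ‖z + Complex.I‖ ^ 2 := by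
  have h : ‖z + Complex.I‖ ≠ 0 := norm_ne_zero_iff.2 (add_I_ne_zero hz)
  have h2 : ‖z + Complex.I‖ ^ 2 - ‖z - Complex.I‖ ^ 2 = 4 * z.im := by
    simp only [Complex.sq_norm, Complex.normSq_apply]
    simp
    ring
  rw [norm_div, ← h2]
  field_simp

lemma cayley_mem_ball {z : ℂ} (hz : 0 < z.im) :
    (z - Complex.I) / (z + Complex.I) ∈ ball (0 : ℂ) 1 := by
  have h := one_sub_norm_cayley_sq hz
  have hp : 0 < 4 * z.im / ‖z + Complex.I‖ ^ 2 := by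
    have : 0 < ‖z + Complex.I‖ := norm_pos_iff.2 (add_I_ne_zero hz)
    positivity
  rw [mem_ball_zero_iff]
  nlinarith [norm_nonneg ((z - Complex.I) / (z + Complex.I))]

lemma poissonKernel_cayley_one {z : ℂ} (hz : 0 < z.im) :
    poissonKernel 0 ((z - Complex.I) / (z + Complex.I)) 1 = z.im := by
  have h := add_I_ne_zero hz
  have h' : ‖z + Complex.I‖ ≠ 0 := norm_ne_zero_iff.2 h
  have h2 : 1 - (z - Complex.I) / (z + Complex.I) = 2 * Complex.I / (z + Complex.I) := by
    field_simp
    ring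
  rw [poissonKernel_def]
  simp only [sub_zero, norm_one, one_pow]
  rw [one_sub_norm_cayley_sq hz, h2, norm_div, norm_mul]
  simp only [Complex.norm_ofNat, Complex.norm_I]
  field_simp
  norm_num

lemma poissonKernel_cayley {z : ℂ} (hz : 0 < z.im) {ζ : ℂ} (hζ : ζ ∈ sphere (0 : ℂ) 1)
    (h1 : ζ ≠ 1) :
    poissonKernel 0 ((z - Complex.I) / (z + Complex.I)) ζ =
      (1 + cayleyReal ζ ^ 2) * (z.im * ‖(z - cayleyReal ζ)⁻¹‖ ^ 2) := by
  have hζt := cayleyReal_sub_I_div hζ h1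
  set t := cayleyReal ζ
  have h := add_I_ne_zero hz
  have h' : ‖z + Complex.I‖ ≠ 0 := norm_ne_zero_iff.2 h
  have ht := ofReal_add_I_ne_zero t
  have ht' : 1 + t ^ 2 ≠ 0 := by positivity
  have htn : ‖(t : ℂ) + Complex.I‖ ^ 2 = 1 + t ^ 2 := by
    rw [Complex.sq_norm, Complex.normSq_apply]
    simp
    ring
  have hzt : ‖z - t‖ ≠ 0 := norm_ne_zero_iff.2 (sub_ofReal_ne_zero hz t)
  have h2 : ζ - (z - Complex.I) / (z + Complex.I) =
      -2 * Complex.I * (z - t) / ((t + Complex.I) * (z + Complex.I)) := by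
    rw [hζt]
    field_simp
    ring
  rw [poissonKernel_def]
  simp only [sub_zero]
  rw [mem_sphere_zero_iff_norm.1 hζ, one_pow, one_sub_norm_cayley_sq hz, h2, norm_div, norm_mul,
    norm_mul, norm_mul, norm_inv, div_pow, mul_pow _ ‖z + Complex.I‖, htn]
  simp only [norm_neg, Complex.norm_ofNat, Complex.norm_I]
  field_simp
  norm_num

lemma exists_lintegral_poissonKernel_cayley (ν : Measure (sphere (0 : ℂ) 1)) :
    ∃ (c : ENNReal) (μ : Measure ℝ), ∀ z : ℂ, 0 < z.im →
      ∫⁻ ζ, ENNReal.ofReal (poissonKernel 0 ((z - Complex.I) / (z + Complex.I)) ζ) ∂ν =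
        c * ENNReal.ofReal z.im + ∫⁻ t : ℝ, ENNReal.ofReal (z.im * ‖(z - t)⁻¹‖ ^ 2) ∂μ := by
  let e : sphere (0 : ℂ) 1 := ⟨1, by simp⟩
  have hτ : Measurable fun ζ : sphere (0 : ℂ) 1 => cayleyReal ζ :=
    measurable_cayleyReal.comp measurable_subtype_coe
  refine ⟨ν {e}, ((ν.restrict {e}ᶜ).withDensity fun ζ =>
    ENNReal.ofReal (1 + cayleyReal ζ ^ 2)).map fun ζ : sphere (0 : ℂ) 1 => cayleyReal ζ,
    fun z hz => ?_⟩
  rw [← lintegral_add_compl _ (measurableSet_singleton e), lintegral_map (by fun_prop) hτ,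
    lintegral_withDensity_eq_lintegral_mul _ (by fun_prop) (by fun_prop)]
  congr 1
  · simp [e, poissonKernel_cayley_one hz, mul_comm]
  · refine setLIntegral_congr_fun (measurableSet_singleton e).compl fun ζ hζ => ?_
    have h1 : (ζ : ℂ) ≠ 1 := fun h => hζ (Subtype.ext h)
    simp only [Pi.mul_apply]
    rw [poissonKernel_cayley hz ζ.2 h1, ENNReal.ofReal_mul (by positivity)]

lemma cayley_inv_im_pos {w : ℂ} (hw : w ∈ ball (0 : ℂ) 1) :
    0 < (Complex.I * (1 + w) / (1 - w)).im := by
  have hw1 : ‖w‖ < 1 := by simpa using hw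
  have hne : 1 - w ≠ 0 := fun h => by
    rw [← sub_eq_zero.1 h, norm_one] at hw1
    exact lt_irrefl _ hw1
  have hn : 0 < Complex.normSq (1 - w) := Complex.normSq_pos.2 hne
  have : (Complex.I * (1 + w) / (1 - w)).im = (1 - ‖w‖ ^ 2) / Complex.normSq (1 - w) := by
    rw [Complex.div_im, Complex.sq_norm, Complex.normSq_apply w]
    simp
    field_simp
    ring
  rw [this]
  have : ‖w‖ ^ 2 < 1 := by nlinarith [norm_nonneg w]
  exact div_pos (by linarith) hn

/-- The imaginary part of the **Nevanlinna representation** of a holomorphic function from the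
upper half-plane to the closed lower half-plane. -/
lemma exists_ofReal_neg_im_eq_lintegral {G : ℂ → ℂ}
    (hd : DifferentiableOn ℂ G {z : ℂ | 0 < z.im}) (him : ∀ z : ℂ, 0 < z.im → (G z).im ≤ 0) :
    ∃ (c : ENNReal) (μ : Measure ℝ), ∀ z : ℂ, 0 < z.im →
      ENNReal.ofReal (-(G z).im) =
        c * ENNReal.ofReal z.im + ∫⁻ t : ℝ, ENNReal.ofReal (z.im * ‖(z - t)⁻¹‖ ^ 2) ∂μ := by
  have hne {w : ℂ} (hw : w ∈ ball (0 : ℂ) 1) : 1 - w ≠ 0 := fun h => by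
    rw [← sub_eq_zero.1 h] at hw
    simp at hw
  obtain ⟨ν, hν⟩ := exists_re_eq_integral_poissonKernel
    (h := fun w => Complex.I * G (Complex.I * (1 + w) / (1 - w)))
    (DifferentiableOn.const_mul (hd.comp
      (fun w hw => by have := hne hw; fun_prop (disch := assumption))
      fun w hw => cayley_inv_im_pos hw) _)
    fun w hw => by simpa using him _ (cayley_inv_im_pos hw)
  obtain ⟨c, μ, hμ⟩ := exists_lintegral_poissonKernel_cayley (ν : Measure (sphere (0 : ℂ) 1))
  refine ⟨c, μ, fun z hz => ?_⟩
  have hw := cayley_mem_ball hz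
  have hzI := add_I_ne_zero hz
  have hinv : Complex.I * (1 + (z - Complex.I) / (z + Complex.I)) /
      (1 - (z - Complex.I) / (z + Complex.I)) = z := by
    have := hne hw
    rw [div_eq_iff this]
    field_simp
    ring
  have hK : Continuous fun ζ : sphere (0 : ℂ) 1 =>
      poissonKernel 0 ((z - Complex.I) / (z + Complex.I)) ζ :=
    (continuousOn_poissonKernel_sphere hw).comp_continuous (by fun_prop) (by simp)
  have hmain := hν _ hw
  simp only [hinv] at hmain
  rw [← hμ z hz, ← ofReal_integral_eq_lintegral_ofReal
    (hK.integrable_of_hasCompactSupport (HasCompactSupport.of_compactSpace _)), ← hmain]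
  · simp
  · refine ae_of_all _ fun ζ => ?_
    have h1 : ‖(ζ : ℂ)‖ = 1 := by simp
    simp only [Pi.zero_apply, poissonKernel_def, sub_zero, h1, one_pow,
      one_sub_norm_cayley_sq hz]
    positivity

end Cayley

/-- A holomorphic function from the upper half-plane to the closed lower half-plane with
`iy G(iy) → 1` as `y → ∞` is the Cauchy transform of a probability measure. -/
theorem exists_eq_cauchyTransform {G : ℂ → ℂ} (hd : DifferentiableOn ℂ G {z : ℂ | 0 < z.im})
    (him : ∀ z : ℂ, 0 < z.im → (G z).im ≤ 0)
    (hlim : Tendsto (fun y : ℝ => (y * Complex.I) * G (y * Complex.I)) atTop (𝓝 1)) :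
    ∃ μ : Measure ℝ, IsProbabilityMeasure μ ∧ ∀ z : ℂ, 0 < z.im → G z = cauchyTransform μ z := by
  obtain ⟨c, μ, hμ⟩ := exists_ofReal_neg_im_eq_lintegral hd him
  have hseq : Tendsto (fun n : ℕ => (n : ℝ) + 1) atTop atTop :=
    tendsto_atTop_add_const_right _ _ tendsto_natCast_atTop_atTop
  have hL : Tendsto (fun n : ℕ => ENNReal.ofReal ((n + 1 : ℝ) *
      -(G ((n + 1 : ℝ) * Complex.I)).im)) atTop (𝓝 1) := by
    rw [← ENNReal.ofReal_one]
    refine ENNReal.tendsto_ofReal ?_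
    have := ((Complex.continuous_re.tendsto 1).comp hlim).comp hseq
    refine this.congr fun n => ?_
    simp
  have hR (n : ℕ) : ENNReal.ofReal ((n + 1 : ℝ) * -(G ((n + 1 : ℝ) * Complex.I)).im) =
      c * ENNReal.ofReal ((n + 1 : ℝ) ^ 2) +
        ∫⁻ t : ℝ, ENNReal.ofReal ((n + 1 : ℝ) ^ 2 / ((n + 1 : ℝ) ^ 2 + t ^ 2)) ∂μ := by
    have hn : (0 : ℝ) < n + 1 := by positivity
    have h := hμ ((n + 1 : ℝ) * Complex.I) (by simpa using hn)
    have him' : ((n + 1 : ℝ) * Complex.I : ℂ).im = n + 1 := by simp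
    rw [him'] at h
    rw [ENNReal.ofReal_mul hn.le, h, mul_add, mul_left_comm, ← ENNReal.ofReal_mul hn.le, ← sq,
      ← lintegral_const_mul' _ _ ENNReal.ofReal_ne_top]
    congr 1
    refine lintegral_congr fun t => ?_
    rw [← ENNReal.ofReal_mul hn.le, norm_inv, inv_pow, Complex.sq_norm, Complex.normSq_apply]
    congr 1
    simp
    ring
  have hmono : Tendsto (fun n : ℕ => ∫⁻ t : ℝ, ENNReal.ofReal
      ((n + 1 : ℝ) ^ 2 / ((n + 1 : ℝ) ^ 2 + t ^ 2)) ∂μ) atTop (𝓝 (∫⁻ _, 1 ∂μ)) := by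
    refine lintegral_tendsto_of_tendsto_of_monotone (fun n => by fun_prop)
      (ae_of_all _ fun t a b hab => ENNReal.ofReal_le_ofReal ?_) (ae_of_all _ fun t => ?_)
    · have hab' : (a + 1 : ℝ) ^ 2 ≤ (b + 1 : ℝ) ^ 2 := by gcongr
      rw [div_le_div_iff₀ (by positivity) (by positivity)]
      nlinarith [sq_nonneg t]
    · rw [← ENNReal.ofReal_one]
      refine ENNReal.tendsto_ofReal ?_
      have h1 : Tendsto (fun n : ℕ => 1 / (1 + t ^ 2 * (((n : ℝ) + 1) ^ 2)⁻¹)) atTop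
          (𝓝 (1 / (1 + t ^ 2 * 0))) := by
        refine Tendsto.div tendsto_const_nhds (Tendsto.const_add _ (Tendsto.const_mul _ ?_))
          (by simp)
        exact tendsto_inv_atTop_zero.comp ((tendsto_pow_atTop two_ne_zero).comp hseq)
      simp only [mul_zero, add_zero, div_one] at h1
      refine h1.congr fun n => ?_
      have hn : (n + 1 : ℝ) ≠ 0 := by positivity
      field_simp
  have hc : c = 0 := by
    by_contra hc
    have htop : Tendsto (fun n : ℕ => c * ENNReal.ofReal ((n + 1 : ℝ) ^ 2)) atTop (𝓝 ⊤) := by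
      have h1 : Tendsto (fun n : ℕ => ENNReal.ofReal ((n + 1 : ℝ) ^ 2)) atTop (𝓝 ⊤) :=
        ENNReal.tendsto_ofReal_nhds_top.2 ((tendsto_pow_atTop two_ne_zero).comp hseq)
      simpa [ENNReal.mul_top hc] using
        ENNReal.Tendsto.const_mul (a := c) h1 (Or.inl ENNReal.top_ne_zero)
    have := le_of_tendsto_of_tendsto' htop hL fun n => by
      rw [hR n]
      exact le_self_add
    simp at this
  have hprob : IsProbabilityMeasure μ := by
    refine ⟨?_⟩
    rw [← lintegral_one]
    refine tendsto_nhds_unique hmono (hL.congr fun n => ?_)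
    rw [hR n, hc, zero_mul, zero_add]
  refine ⟨μ, hprob, ?_⟩
  have himeq (z : ℂ) (hz : 0 < z.im) : (G z).im = (cauchyTransform μ z).im := by
    have h := hμ z hz
    rw [hc, zero_mul, zero_add, ← ofReal_integral_eq_lintegral_ofReal
      ((integrable_norm_inv_sub_ofReal_sq hz).const_mul _) (ae_of_all _ fun x => by positivity),
      ENNReal.ofReal_eq_ofReal_iff (by linarith [him z hz])
      (integral_nonneg fun x => by positivity), integral_const_mul] at h
    rw [cauchyTransform_im hz, ← h, neg_neg]
  have hopen : IsOpen {z : ℂ | 0 < z.im} := isOpen_lt continuous_const Complex.continuous_im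
  obtain ⟨a, ha⟩ := ((hd.sub (differentiableOn_cauchyTransform (μ := μ))).analyticOnNhd
    hopen).eq_const_of_im_eq_const (c₀ := 0) (fun z hz => by simp [himeq z hz]) hopen
    ((convex_halfSpace_im_gt 0).isConnected ⟨Complex.I, by simp⟩)
  have hzero : a = 0 := by
    have h1 := (hlim.sub (tendsto_mul_cauchyTransform (μ := μ))).mul
      (Complex.continuous_ofReal.tendsto 0 |>.comp tendsto_inv_atTop_zero)
    rw [sub_self, zero_mul] at h1
    have h2 : Tendsto (fun _ : ℝ => Complex.I * a) atTop (𝓝 0) := by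
      refine h1.congr' ?_
      filter_upwards [eventually_gt_atTop 0] with y hy
      have hy' : (y : ℂ) ≠ 0 := Complex.ofReal_ne_zero.2 hy.ne'
      rw [← ha (y * Complex.I) (by simpa using hy), Pi.sub_apply, Function.comp_apply,
        Complex.ofReal_inv]
      field_simp
    simpa using tendsto_nhds_unique tendsto_const_nhds h2
  intro z hz
  simpa [hzero, sub_eq_zero] using ha z hz

/-- Characterization of F-transforms: a holomorphic self-map `F` of the upper half-plane
is the F-transform of a probability measure on ℝ iff `F(iy)/(iy) → 1` as `y → ∞`;
moreover every F-transform satisfies `Im F_μ(z) ≥ Im z` on ℍ. -/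
theorem Ftransform_characterization :
    (∀ F : ℂ → ℂ, DifferentiableOn ℂ F {z : ℂ | 0 < z.im} →
      (∀ z : ℂ, 0 < z.im → 0 < (F z).im) →
      ((∃ μ : Measure ℝ, IsProbabilityMeasure μ ∧
          ∀ z : ℂ, 0 < z.im → F z = Ftransform μ z)
        ↔ Tendsto (fun y : ℝ => F ((y : ℂ) * Complex.I) / ((y : ℂ) * Complex.I))
            atTop (nhds 1)))
    ∧ (∀ μ : Measure ℝ, IsProbabilityMeasure μ →
        ∀ z : ℂ, 0 < z.im → z.im ≤ (Ftransform μ z).im) := by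
  refine ⟨fun F hd hF => ⟨?_, fun hlim => ?_⟩, fun μ _ z hz => im_le_Ftransform_im hz⟩
  · rintro ⟨μ, _, hμ⟩
    have h := (tendsto_mul_cauchyTransform (μ := μ)).inv₀ one_ne_zero
    rw [inv_one] at h
    refine h.congr' ?_
    filter_upwards [eventually_gt_atTop 0] with y hy
    rw [hμ _ (by simpa using hy), Ftransform, mul_inv, div_eq_mul_inv, mul_comm]
  · have hne (z : ℂ) (hz : 0 < z.im) : F z ≠ 0 := fun h => by simpa [h] using hF z hz
    obtain ⟨μ, hμ, h⟩ := exists_eq_cauchyTransform (G := fun z => (F z)⁻¹) (hd.inv hne)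
      (fun z hz => by
        rw [Complex.inv_im]
        exact div_nonpos_of_nonpos_of_nonneg (neg_nonpos.2 (hF z hz).le) (Complex.normSq_nonneg _))
      (by simpa [div_eq_mul_inv, mul_comm] using hlim.inv₀ one_ne_zero)
    exact ⟨μ, hμ, fun z hz => by rw [Ftransform, ← h z hz, inv_inv]⟩
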